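/- Let $A$ be a domain of prime characteristic $p > 0$ with fraction field $K$, and let $X$ be a scheme of finite type over $\Spec(A)$. Then there exists $e > 0$ such that the generic fiber of $(X \times_{\Spec A} \Spec A^{1/p^e})_{\mathrm{red}} \to \Spec(A^{1/p^e})$ is geometrically reduced over $K^{1/p^e}$. -/

import Mathlib

open Module IsLocalRing

section Frob

/-- `F^e_* M`: the abelian group `M` with `R`-module structure restricted along the
`e`-th iterated Frobenius of `R`. -/
def FrobMod (p e : ℕ) (R M : Type*) : Type _ := M

instance FrobMod.addCommGroup {p e : ℕ} {R M : Type*} [AddCommGroup M] :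
    AddCommGroup (FrobMod p e R M) :=
  inferInstanceAs (AddCommGroup M)

noncomputable instance FrobMod.module {p e : ℕ} {R M : Type*} [CommRing R] [ExpChar R p]
    [AddCommGroup M] [Module R M] : Module R (FrobMod p e R M) :=
  Module.compHom M (iterateFrobenius R p e)

/-- `F^e_* B` (a.k.a. `B^{1/p^e}`) as a ring. -/
def FrobAlg (p e : ℕ) (B : Type*) : Type _ := B

instance FrobAlg.commRing {p e : ℕ} {B : Type*} [CommRing B] : CommRing (FrobAlg p e B) :=
  inferInstanceAs (CommRing B)

/-- If `B` is an `A`-algebra, then `F^e_* B` is an `A`-algebra via `A → B` composed with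
the `e`-th iterated Frobenius of `B`. -/
noncomputable instance FrobAlg.algebra {p e : ℕ} {A B : Type*} [CommRing A] [CommRing B]
    [Algebra A B] [ExpChar B p] : Algebra A (FrobAlg p e B) :=
  ((iterateFrobenius B p e).comp (algebraMap A B)).toAlgebra

/-- The `p`-degree `[k^{1/p^e} : k]` of a ring `k` of characteristic `p`. -/
noncomputable def pDeg (p e : ℕ) (k : Type*) [CommRing k] [ExpChar k p] : ℕ :=
  Module.finrank k (FrobAlg p e k)

/-- The length of an `R`-module `M`, as the Krull dimension of its submodule lattice. -/
noncomputable def modLength (R M : Type*) [CommRing R] [AddCommGroup M] [Module R M] :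
    WithBot ℕ∞ :=
  Order.krullDim (Submodule R M)

/-- The minimal number of generators of an `R`-module `M`. -/
noncomputable def minGens (R M : Type*) [CommRing R] [AddCommGroup M] [Module R M] : ℕ :=
  sInf {n : ℕ | ∃ s : Finset M, s.card = n ∧ Submodule.span R (s : Set M) = ⊤}

/-- The bracket power `I^{[p^e]}`. -/
noncomputable def bracketPow {R : Type*} [CommRing R] (p e : ℕ) [ExpChar R p] (I : Ideal R) :
    Ideal R :=
  I.map (iterateFrobenius R p e)

end Frob

instance FrobAlg.isDomain {p e : ℕ} {B : Type*} [CommRing B] [IsDomain B] :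
    IsDomain (FrobAlg p e B) :=
  inferInstanceAs (IsDomain B)

universe u v

open TensorProduct in
/-- A commutative algebra `S` over a field `K` is geometrically reduced if `L ⊗_K S` is
reduced for every field extension `L` of `K`. -/
def GeomReduced (K : Type u) (S : Type v) [Field K] [CommRing S] [Algebra K S] : Prop :=
  ∀ (L : Type (max u v)) [Field L] [Algebra K L], IsReduced (TensorProduct K L S)

section

open TensorProduct

/-- Over a perfect field of characteristic `p`, `p`-th powers of linearly independent elements of a
reduced algebra are linearly independent. -/
lemma LinearIndependent.pow_char_of_perfectRing {k V ι : Type*} (p : ℕ) [Fact p.Prime] [Field k]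
    [CharP k p] [PerfectRing k p] [CommRing V] [Algebra k V] [IsReduced V] {v : ι → V}
    (hv : LinearIndependent k v) : LinearIndependent k (fun i => v i ^ p) := by
  cases subsingleton_or_nontrivial V
  · have : IsEmpty ι := ⟨fun i => hv.ne_zero i (Subsingleton.elim _ _)⟩
    exact linearIndependent_empty_type
  have : CharP V p := charP_of_injective_algebraMap (algebraMap k V).injective p
  rw [linearIndependent_iff'] at hv ⊢
  intro s c hc i hi
  choose d hd using fun i => (PerfectRing.bijective_frobenius (R := k) (p := p)).2 (c i)
  have h : (∑ i ∈ s, d i • v i) ^ p = 0 := by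
    rw [sum_pow_char, ← hc]
    exact Finset.sum_congr rfl fun i _ => by rw [smul_pow]; exact congrArg (· • v i ^ p) (hd i)
  have := hv s d (pow_eq_zero_iff (Fact.out : p.Prime).ne_zero |>.1 h) i hi
  rw [← hd, this]
  exact zero_pow (Fact.out : p.Prime).ne_zero

/-- The tensor product of two reduced algebras over a perfect field of characteristic `p` is
reduced. -/
lemma TensorProduct.isReduced_of_perfectRing {k V W : Type*} (p : ℕ) [Fact p.Prime] [Field k]
    [CharP k p] [PerfectRing k p] [CommRing V] [Algebra k V] [IsReduced V] [CommRing W]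
    [Algebra k W] [IsReduced W] : IsReduced (V ⊗[k] W) := by
  cases subsingleton_or_nontrivial (V ⊗[k] W)
  · infer_instance
  have : CharP (V ⊗[k] W) p :=
    charP_of_injective_algebraMap (algebraMap k (V ⊗[k] W)).injective p
  rw [isReduced_iff_pow_one_lt p (Fact.out : p.Prime).one_lt]
  intro x hx
  let v := Module.Free.chooseBasis k V
  let w := Module.Free.chooseBasis k W
  let b := v.tensorProduct w
  have hb : LinearIndependent k fun ij => b ij ^ p := by
    have := (v.linearIndependent.pow_char_of_perfectRing p).tmul_of_isDomain
      (w.linearIndependent.pow_char_of_perfectRing p)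
    have hpow : (fun ij => b ij ^ p) = fun ij => (v ij.1 ^ p) ⊗ₜ[k] (w ij.2 ^ p) := by
      ext ij
      rw [← Algebra.TensorProduct.tmul_pow]
      exact congrArg (· ^ p) (v.tensorProduct_apply w ij.1 ij.2)
    rw [hpow]
    exact this
  rw [← b.linearCombination_repr x, Finsupp.linearCombination_apply, Finsupp.sum,
    sum_pow_char] at hx
  simp_rw [smul_pow] at hx
  refine b.ext_elem fun i => ?_
  rw [map_zero, Finsupp.zero_apply]
  by_contra h
  refine h (pow_eq_zero_iff (Fact.out : p.Prime).ne_zero |>.1 ?_)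
  exact linearIndependent_iff'.1 hb _ (fun i => b.repr x i ^ p) hx i (Finsupp.mem_support_iff.2 h)

/-- Two extensions of a field have a common extension. -/
lemma Field.exists_compositum.{w₁, w₂, w₃} (k : Type w₁) (L : Type w₂) (P : Type w₃)
    [Field k] [Field L] [Field P] [Algebra k L] [Algebra k P] :
    ∃ (M : Type (max w₂ w₃)) (_ : Field M) (_ : Algebra k M),
      Nonempty (L →ₐ[k] M) ∧ Nonempty (P →ₐ[k] M) := by
  obtain ⟨m, hm⟩ := Ideal.exists_maximal (L ⊗[k] P)
  exact ⟨L ⊗[k] P ⧸ m, Ideal.Quotient.field m, inferInstance,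
    ⟨(Ideal.Quotient.mkₐ k m).comp Algebra.TensorProduct.includeLeft⟩,
    ⟨(Ideal.Quotient.mkₐ k m).comp Algebra.TensorProduct.includeRight⟩⟩

/-- An algebra which is reduced over a perfect extension is reduced over every extension. -/
lemma TensorProduct.isReduced_of_isReduced_perfectRing {k L P T : Type*} (p : ℕ) [Fact p.Prime]
    [Field k] [Field L] [Field P] [Algebra k L] [Algebra k P] [CharP P p] [PerfectRing P p]
    [CommRing T] [Algebra k T] [IsReduced (P ⊗[k] T)] : IsReduced (L ⊗[k] T) := by
  obtain ⟨M, _, _, ⟨f⟩, ⟨g⟩⟩ := Field.exists_compositum k L P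
  let := g.toAlgebra
  have : IsScalarTower k P M := .of_algebraMap_eq fun x => (g.commutes x).symm
  have : IsReduced (M ⊗[P] (P ⊗[k] T)) := TensorProduct.isReduced_of_perfectRing p
  have : IsReduced (M ⊗[k] T) := isReduced_of_injective
    (Algebra.TensorProduct.cancelBaseChange k P M M T).symm
    (Algebra.TensorProduct.cancelBaseChange k P M M T).symm.injective
  exact isReduced_of_injective (Algebra.TensorProduct.map f (AlgHom.id k T))
    (Module.Flat.rTensor_preserves_injective_linearMap f.toLinearMap f.injective)

/-- The kernel of base change from a domain to a field containing it is torsion. -/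
lemma exists_smul_eq_zero_of_one_tmul_eq_zero {B P M : Type*} [CommRing B] [IsDomain B] [Field P]
    [Algebra B P] (hP : Function.Injective (algebraMap B P)) [AddCommGroup M] [Module B M] {m : M}
    (hm : (1 : P) ⊗ₜ[B] m = 0) : ∃ b : B, b ≠ 0 ∧ b • m = 0 := by
  let K := FractionRing B
  let : Algebra K P := (IsFractionRing.lift hP).toAlgebra
  have : IsScalarTower B K P := .of_algebraMap_eq fun x => (IsFractionRing.lift_algebraMap hP x).symm
  have h1 : (1 : P) ⊗ₜ[K] ((1 : K) ⊗ₜ[B] m) = 0 := by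
    apply (AlgebraTensorModule.cancelBaseChange B K P P M).injective
    simpa using hm
  have h2 : (1 : K) ⊗ₜ[B] m = 0 := by
    have hinj : Function.Injective (TensorProduct.mk K P (K ⊗[B] M) 1) :=
      Module.FaithfullyFlat.tensorProduct_mk_injective _
    exact hinj (by simpa using h1)
  obtain ⟨c, hc⟩ := (IsLocalizedModule.eq_zero_iff (nonZeroDivisors B)
    (TensorProduct.mk B K M 1)).1 h2
  exact ⟨c, nonZeroDivisors.ne_zero c.2, hc⟩

/-- If the nilradical of `P ⊗ M` is generated by elements that descend to `M` up to a denominator,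
then reduction commutes with the base change to `P`. -/
lemma isReduced_tensorProduct_quotient_nilradical {B P M : Type*} [CommRing B] [IsDomain B]
    [Field P] [Algebra B P] (hP : Function.Injective (algebraMap B P)) [CommRing M] [Algebra B M]
    (s : Set (P ⊗[B] M)) (hs : nilradical (P ⊗[B] M) = Ideal.span s)
    (h : ∀ f ∈ s, ∃ d : B, d ≠ 0 ∧ ∃ g : M, d • f = 1 ⊗ₜ g) :
    IsReduced (P ⊗[B] (M ⧸ nilradical M)) := by
  let q := Ideal.Quotient.mkₐ B (nilradical M)
  have hq : Function.Surjective q := Ideal.Quotient.mk_surjective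
  let Ψ := Algebra.TensorProduct.map (AlgHom.id B P) q
  have hker : nilradical (P ⊗[B] M) ≤ RingHom.ker Ψ := by
    rw [hs, Ideal.span_le]
    intro f hf
    obtain ⟨d, hd, g, hg⟩ := h f hf
    have hnil : f ∈ nilradical (P ⊗[B] M) := hs ▸ Ideal.subset_span hf
    obtain ⟨n, hn⟩ := mem_nilradical.1 hnil
    have hgn : (1 : P) ⊗ₜ[B] (g ^ n) = 0 := by
      have : (d • f) ^ n = 0 := by rw [smul_pow, hn, smul_zero]
      rwa [hg, Algebra.TensorProduct.tmul_pow, one_pow] at this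
    obtain ⟨b, hb, hbg⟩ := exists_smul_eq_zero_of_one_tmul_eq_zero hP hgn
    have hq0 : q (b • g) = 0 := Ideal.Quotient.eq_zero_iff_mem.2 <| mem_nilradical.2
      ⟨n + 1, by rw [smul_pow, pow_succ, pow_succ, mul_smul, ← smul_mul_assoc, hbg, zero_mul,
        smul_zero]⟩
    have : (b * d) • Ψ f = 0 := by
      rw [← map_smul, mul_smul, hg, ← TensorProduct.tmul_smul]
      simp only [Ψ, Algebra.TensorProduct.map_tmul, hq0, tmul_zero]
    rw [← algebraMap_smul P, smul_eq_zero] at this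
    exact this.resolve_left ((map_ne_zero_iff _ hP).2 (mul_ne_zero hb hd))
  refine ⟨fun y ⟨n, hn⟩ => ?_⟩
  obtain ⟨w, rfl⟩ : ∃ w, Ψ w = y := TensorProduct.map_surjective Function.surjective_id hq y
  refine hker (mem_nilradical.2 ?_)
  have hw : w ^ n ∈ RingHom.ker Ψ := by simpa using hn
  have hle : RingHom.ker Ψ ≤ nilradical (P ⊗[B] M) := by
    have := Algebra.TensorProduct.lTensor_ker (A := P) q hq
    refine this.trans_le (Ideal.map_le_iff_le_comap.2 fun g hg => ?_)
    rw [show RingHom.ker q = nilradical M from Ideal.Quotient.mkₐ_ker B _] at hg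
    exact mem_nilradical.2 ((mem_nilradical.1 hg).map _)
  obtain ⟨m, hm⟩ := hle hw
  exact ⟨n * m, by rw [pow_mul, hm]⟩

/-- If every element of `P` is up to a denominator a `p`-power root of an element of `A`, then the
same holds for the coefficients of elements of `P ⊗ R`. -/
lemma exists_smul_mem_span_pow_mem_range {A P R : Type*} (p : ℕ) [CommRing A] [IsDomain A] [Field P]
    [Algebra A P] [CommRing R] [Algebra A R]
    (h : ∀ x : P, ∃ (n : ℕ) (d : A), d ≠ 0 ∧ (d • x) ^ p ^ n ∈ (algebraMap A P).range)
    (f : P ⊗[A] R) : ∃ (n₀ : ℕ) (d : A), d ≠ 0 ∧ ∀ n, n₀ ≤ n →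
      d • f ∈ Submodule.span A
        {z | ∃ (x : P) (r : R), x ^ p ^ n ∈ (algebraMap A P).range ∧ x ⊗ₜ r = z} := by
  induction f with
  | zero => exact ⟨0, 1, one_ne_zero, fun n _ => by simp⟩
  | tmul x r =>
    obtain ⟨n₀, d, hd, hx⟩ := h x
    refine ⟨n₀, d, hd, fun n hn => Submodule.subset_span ⟨d • x, r, ?_, TensorProduct.smul_tmul' ..⟩⟩
    rw [← Nat.add_sub_of_le hn, pow_add, pow_mul]
    exact pow_mem hx _
  | add f g hf hg =>
    obtain ⟨n₁, d₁, hd₁, h₁⟩ := hf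
    obtain ⟨n₂, d₂, hd₂, h₂⟩ := hg
    refine ⟨max n₁ n₂, d₁ * d₂, mul_ne_zero hd₁ hd₂, fun n hn => ?_⟩
    rw [smul_add]
    refine add_mem ?_ ?_
    · rw [mul_comm, mul_smul]
      exact Submodule.smul_mem _ _ (h₁ n (le_of_max_le_left hn))
    · rw [mul_smul]
      exact Submodule.smul_mem _ _ (h₂ n (le_of_max_le_right hn))

/-- The embedding of `A^{1/p^e}` into a perfect field containing `A`. -/
noncomputable def FrobAlg.toPerfect (p e : ℕ) (A P : Type*) [CommRing A] [Field P] [ExpChar P p]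
    [PerfectRing P p] [Algebra A P] : FrobAlg p e A →+* P :=
  ((iterateFrobeniusEquiv P p e).symm : P →+* P).comp (algebraMap A P)

lemma FrobAlg.toPerfect_pow {p e : ℕ} {A P : Type*} [CommRing A] [Field P] [ExpChar P p]
    [PerfectRing P p] [Algebra A P] (a : A) :
    FrobAlg.toPerfect p e A P (show FrobAlg p e A from a) ^ p ^ e = algebraMap A P a :=
  (iterateFrobeniusEquiv P p e).apply_symm_apply (algebraMap A P a)

lemma FrobAlg.toPerfect_injective {p e : ℕ} {A P : Type*} [CommRing A] [Field P] [ExpChar P p]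
    [PerfectRing P p] [Algebra A P] (hA : Function.Injective (algebraMap A P)) :
    Function.Injective (FrobAlg.toPerfect p e A P) :=
  (iterateFrobeniusEquiv P p e).symm.injective.comp hA

lemma FrobAlg.toPerfect_algebraMap {p e : ℕ} {A P : Type*} [CommRing A] [ExpChar A p] [Field P]
    [ExpChar P p] [PerfectRing P p] [Algebra A P] (a : A) :
    FrobAlg.toPerfect p e A P (algebraMap A (FrobAlg p e A) a) = algebraMap A P a := by
  apply (iterateFrobeniusEquiv P p e).injective
  refine (FrobAlg.toPerfect_pow (iterateFrobenius A p e a)).trans ?_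
  rw [iterateFrobenius_def, map_pow, iterateFrobeniusEquiv_def]

/-- Every element of the perfect closure of the fraction field of `A` is, up to a denominator, a
`p`-power root of an element of `A`. -/
lemma exists_smul_pow_mem_range_of_isPRadical {A K P : Type*} (p : ℕ) [Fact p.Prime] [CommRing A]
    [IsDomain A] [Field K] [Algebra A K] [IsFractionRing A K] [Field P] [Algebra A P] [Algebra K P]
    [IsScalarTower A K P] [IsPRadical (algebraMap K P) p] (x : P) :
    ∃ (n : ℕ) (d : A), d ≠ 0 ∧ (d • x) ^ p ^ n ∈ (algebraMap A P).range := by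
  obtain ⟨n, y, hy⟩ := IsPRadical.pow_mem (algebraMap K P) p x
  obtain ⟨⟨a, d⟩, had⟩ := IsLocalization.surj (nonZeroDivisors A) y
  refine ⟨n, d, nonZeroDivisors.ne_zero d.2, a * d ^ (p ^ n - 1), ?_⟩
  have hp : p ^ n = (p ^ n - 1) + 1 :=
    (Nat.sub_add_cancel (pow_pos (Fact.out : p.Prime).pos n)).symm
  have h1 : algebraMap A P a = x ^ p ^ n * algebraMap A P d := by
    rw [← hy, IsScalarTower.algebraMap_apply A K P, IsScalarTower.algebraMap_apply A K P d,
      ← map_mul, had]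
  rw [map_mul, map_pow, h1, Algebra.smul_def, mul_pow, mul_comm (algebraMap A P d ^ p ^ n), mul_assoc,
    ← pow_succ', ← hp]

/-- For large `e`, the reduction of `A^{1/p^e} ⊗ R` stays reduced over the perfect closure. -/
lemma exists_isReduced_tensorProduct_frobAlg {A P R : Type*} (p : ℕ) [CommRing A] [IsDomain A]
    [ExpChar A p] [Field P] [ExpChar P p] [PerfectRing P p] [Algebra A P]
    (hA : Function.Injective (algebraMap A P))
    (h : ∀ x : P, ∃ (n : ℕ) (d : A), d ≠ 0 ∧ (d • x) ^ p ^ n ∈ (algebraMap A P).range)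
    [CommRing R] [Algebra A R] [Algebra.FiniteType A R] :
    ∃ e₀ : ℕ, ∀ e, e₀ ≤ e → ∀ [Algebra (FrobAlg p e A) P],
      algebraMap (FrobAlg p e A) P = FrobAlg.toPerfect p e A P →
      IsReduced (P ⊗[FrobAlg p e A]
        ((FrobAlg p e A ⊗[A] R) ⧸ nilradical (FrobAlg p e A ⊗[A] R))) := by
  have : IsNoetherianRing (P ⊗[A] R) := Algebra.FiniteType.isNoetherianRing P _
  obtain ⟨s, hs⟩ := (isNoetherianRing_iff_ideal_fg _).1 this (nilradical (P ⊗[A] R))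
  choose n d hd hn using exists_smul_mem_span_pow_mem_range (R := R) p h
  refine ⟨s.sup n, fun e he _ halg => ?_⟩
  set B := FrobAlg p e A
  have : IsScalarTower A B P := .of_algebraMap_eq fun a => by
    rw [halg, FrobAlg.toPerfect_algebraMap]
  have hB : Function.Injective (algebraMap B P) := halg ▸ FrobAlg.toPerfect_injective hA
  let σ := Algebra.TensorProduct.cancelBaseChange A B P P R
  have hσ (g : B ⊗[A] R) : σ (1 ⊗ₜ g) =
      Algebra.TensorProduct.map (IsScalarTower.toAlgHom A B P) (AlgHom.id A R) g := by
    induction g with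
    | zero => simp
    | tmul b r => simp [σ, Algebra.smul_def]
    | add x y hx hy => rw [tmul_add, map_add, hx, hy, map_add]
  refine isReduced_tensorProduct_quotient_nilradical hB (Set.image σ.symm s) ?_ ?_
  · rw [← Ideal.map_span, hs]
    ext z
    rw [Ideal.mem_map_of_equiv]
    simp only [mem_nilradical]
    exact ⟨fun hz => ⟨σ z, hz.map σ, σ.symm_apply_apply z⟩, fun ⟨x, hx, h⟩ => h ▸ hx.map σ.symm⟩
  · rintro _ ⟨f, hf, rfl⟩
    have hmem := hn f e ((Finset.le_sup hf).trans he)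
    have hle : Submodule.span A {z | ∃ (x : P) (r : R), x ^ p ^ e ∈ (algebraMap A P).range ∧
        x ⊗ₜ r = z} ≤ LinearMap.range (Algebra.TensorProduct.map (IsScalarTower.toAlgHom A B P)
          (AlgHom.id A R)).toLinearMap := by
      rw [Submodule.span_le]
      rintro _ ⟨x, r, ⟨a, ha⟩, rfl⟩
      obtain ⟨b, hb⟩ : ∃ b : B, algebraMap B P b = x := by
        refine ⟨a, (iterateFrobeniusEquiv P p e).injective ?_⟩
        rw [halg]
        exact (FrobAlg.toPerfect_pow a).trans ha
      exact ⟨b ⊗ₜ r, by simp [hb]⟩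
    obtain ⟨g, hg⟩ := hle hmem
    refine ⟨algebraMap A B (d f), ?_, g, ?_⟩
    · have : Function.Injective (algebraMap A B) := by
        refine Function.Injective.of_comp (f := algebraMap B P) ?_
        rwa [← RingHom.coe_comp, ← IsScalarTower.algebraMap_eq]
      exact (map_ne_zero_iff _ this).2 (hd f)
    · apply σ.injective
      rw [hσ, algebraMap_smul]
      refine Eq.trans ?_ hg.symm
      rw [← algebraMap_smul P, map_smul, algebraMap_smul]
      exact congrArg (d f • ·) (σ.apply_symm_apply f)

end

open TensorProduct in
/-- Let `A` be a domain of characteristic `p > 0` and `R` a finite type `A`-algebra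
(so that `X = Spec R` is a finite type scheme over `Spec A`).  Then there is an `e > 0`
such that the generic fiber of `(X_{A^{1/p^e}})_red → Spec A^{1/p^e}`, namely
`K^{1/p^e} ⊗_{A^{1/p^e}} ((A^{1/p^e} ⊗_A R)/nilradical)`, is geometrically reduced over
`K^{1/p^e} = Frac(A^{1/p^e})`. -/
theorem stmt16 (p : ℕ) [Fact p.Prime] (A : Type u) [CommRing A] [IsDomain A] [CharP A p]
    (R : Type u) [CommRing R] [Algebra A R] [Algebra.FiniteType A R] :
    ∃ e : ℕ, 0 < e ∧
      GeomReduced (FractionRing (FrobAlg p e A))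
        (TensorProduct (FrobAlg p e A) (FractionRing (FrobAlg p e A))
          ((TensorProduct A (FrobAlg p e A) R) ⧸
            nilradical (TensorProduct A (FrobAlg p e A) R))) := by
  let K := FractionRing A
  let P := PerfectClosure K p
  let _ : Algebra K P := (PerfectClosure.of K p).toAlgebra
  let _ : Algebra A P := ((algebraMap K P).comp (algebraMap A K)).toAlgebra
  have : IsScalarTower A K P := .of_algebraMap_eq fun _ => rfl
  have : IsPRadical (algebraMap K P) p := inferInstanceAs (IsPRadical (PerfectClosure.of K p) p)
  have hA : Function.Injective (algebraMap A P) :=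
    (algebraMap K P).injective.comp (IsFractionRing.injective A K)
  obtain ⟨e, he⟩ := exists_isReduced_tensorProduct_frobAlg (R := R) p hA
    (exists_smul_pow_mem_range_of_isPRadical (K := K) p)
  refine ⟨e + 1, e.succ_pos, fun L _ _ => ?_⟩
  let B := FrobAlg p (e + 1) A
  let _ : Algebra B P := (FrobAlg.toPerfect p (e + 1) A P).toAlgebra
  have hB : Function.Injective (algebraMap B P) := FrobAlg.toPerfect_injective hA
  let _ : Algebra (FractionRing B) P := (IsFractionRing.lift hB).toAlgebra
  have : IsScalarTower B (FractionRing B) P :=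
    .of_algebraMap_eq fun x => (IsFractionRing.lift_algebraMap hB x).symm
  let Q := (B ⊗[A] R) ⧸ nilradical (B ⊗[A] R)
  have : IsReduced (P ⊗[B] Q) := he (e + 1) e.le_succ rfl
  let σ := Algebra.TensorProduct.cancelBaseChange B (FractionRing B) P P Q
  have : IsReduced (P ⊗[FractionRing B] (FractionRing B ⊗[B] Q)) :=
    isReduced_of_injective σ σ.injective
  exact TensorProduct.isReduced_of_isReduced_perfectRing (P := P) p
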